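/- arXiv:math-ph/0603011 — 2 statements merged into one kernel-verified Lean document; each statement's English description precedes it below -/
import Mathlib

section
/- Let d ≥ 3, α = (d-2)/2, l a nonnegative integer, and η ∈ S^{d-1}. Define Z^l_η(ξ) = C^α_l((ξ|η))/C^α_l(1) for ξ ∈ S^{d-1}. Then Z^l_η is a reproducing kernel for the space ℋ^l of harmonic homogeneous polynomials of degree l: for every P ∈ ℋ^l, (dim ℋ^l) · ∫_{S^{d-1}} Z^l_η(ξ) P(ξ) dσ(ξ) = P(η), where dim ℋ^l = 2(l+α)Γ(2α+l)/(Γ(l+1)Γ(2α+1)). -/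
open MeasureTheory MvPolynomial Finset
open scoped RealInnerProductSpace

noncomputable section

/-- The Euclidean Laplacian `Δ = Σ_{j=1}^d ∂²/∂x_j²` acting on polynomials on `ℝ^d`. -/
def lap {d : ℕ} (P : MvPolynomial (Fin d) ℝ) : MvPolynomial (Fin d) ℝ :=
  ∑ i, pderiv i (pderiv i P)

/-- The rotation-invariant surface measure on `ℝ^d` (the `(d-1)`-dimensional Hausdorff
measure) normalized so that the unit sphere `S^{d-1}` has total mass `1`. -/
def sphereMeasure (d : ℕ) : Measure (EuclideanSpace ℝ (Fin d)) :=
  (μH[(d : ℝ) - 1] (Metric.sphere (0 : EuclideanSpace ℝ (Fin d)) 1))⁻¹ • μH[(d : ℝ) - 1]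

/-- The Gegenbauer polynomial of degree `m` and index `α`. -/
def gegenbauer (α : ℝ) (m : ℕ) (t : ℝ) : ℝ :=
  ∑ j ∈ Finset.range (m / 2 + 1),
    (-1) ^ j * Real.Gamma (α + m - j) /
      (Real.Gamma α * Real.Gamma (j + 1) * Real.Gamma ((m : ℝ) + 1 - 2 * j)) *
      (2 * t) ^ (m - 2 * j)

section MeasurePart

variable {d : ℕ}

lemma finrank_orth (hd : 3 ≤ d) {v : EuclideanSpace ℝ (Fin d)} (hv : ‖v‖ = 1) :
    (Module.finrank ℝ (ℝ ∙ v)ᗮ : ℝ) = (d : ℝ) - 1 := by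
  have hv0 : v ≠ 0 := by
    intro h
    simp [h] at hv
  have h1 : Module.finrank ℝ (ℝ ∙ v)ᗮ + 1 = d := by
    have := Submodule.finrank_add_finrank_orthogonal (ℝ ∙ v)
    rw [finrank_span_singleton hv0] at this
    simp at this
    omega
  have h2 : ((Module.finrank ℝ (ℝ ∙ v)ᗮ : ℝ)) + 1 = d := by exact_mod_cast h1
  linarith

lemma hemisphere_lt_top (hd : 3 ≤ d) {v : EuclideanSpace ℝ (Fin d)} (hv : ‖v‖ = 1) :
    μH[(d : ℝ) - 1] {x : EuclideanSpace ℝ (Fin d) | ‖x‖ = 1 ∧ ⟪v, x⟫ ≤ 0} < ⊤ := by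
  have hfr := finrank_orth hd hv
  let f : (ℝ ∙ v)ᗮ → EuclideanSpace ℝ (Fin d) := fun w => stereoInvFunAux v (w : EuclideanSpace ℝ (Fin d))
  have hsubt : ContDiff ℝ 1 (fun w : (ℝ ∙ v)ᗮ => (w : EuclideanSpace ℝ (Fin d))) :=
    (ℝ ∙ v)ᗮ.subtypeL.contDiff
  have hf : ContDiff ℝ 1 f :=
    contDiff_stereoInvFunAux.comp hsubt
  obtain ⟨K, hK⟩ := hf.contDiffOn.exists_lipschitzOnWith (s := Metric.closedBall 0 2) one_ne_zero
    (convex_closedBall _ _) (isCompact_closedBall _ _)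
  have hsub : {x : EuclideanSpace ℝ (Fin d) | ‖x‖ = 1 ∧ ⟪v, x⟫ ≤ 0} ⊆ f '' Metric.closedBall 0 2 := by
    rintro x ⟨hx, hvx⟩
    have hne : x ≠ v := by
      rintro rfl
      rw [real_inner_self_eq_norm_sq, hx] at hvx
      norm_num at hvx
    have := stereo_left_inv hv (x := ⟨x, by simp [hx]⟩) hne
    refine ⟨stereoToFun v x, ?_, congrArg Subtype.val this⟩
    rw [mem_closedBall_zero_iff, stereoToFun_apply, norm_smul]
    have h1 : ‖(ℝ ∙ v)ᗮ.orthogonalProjectionOnto x‖ ≤ 1 := by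
      rw [← hx]
      exact Submodule.norm_orthogonalProjectionOnto_apply_le _ _
    have h2 : ‖(2 / ((1 : ℝ) - innerSL ℝ v x))‖ ≤ 2 := by
      rw [innerSL_apply_apply, Real.norm_eq_abs, abs_of_nonneg (by apply div_nonneg <;> linarith)]
      rw [div_le_iff₀ (by linarith)]
      linarith
    calc _ ≤ (2 : ℝ) * 1 := mul_le_mul h2 h1 (norm_nonneg _) (by norm_num)
      _ = 2 := by norm_num
  have hd0 : (0 : ℝ) ≤ (d : ℝ) - 1 := by rw [← hfr]; positivity
  refine (measure_mono hsub).trans_lt ((hK.hausdorffMeasure_image_le hd0).trans_lt ?_)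
  refine ENNReal.mul_lt_top (ENNReal.rpow_lt_top_of_nonneg hd0 ENNReal.coe_ne_top) ?_
  rw [← hfr]
  exact (isCompact_closedBall (0 : (ℝ ∙ v)ᗮ) 2).measure_lt_top

lemma exists_unit (hd : 3 ≤ d) : ∃ v : EuclideanSpace ℝ (Fin d), ‖v‖ = 1 :=
  ⟨EuclideanSpace.single ⟨0, by omega⟩ 1, by simp⟩

lemma sphere_lt_top (hd : 3 ≤ d) :
    μH[(d : ℝ) - 1] (Metric.sphere (0 : EuclideanSpace ℝ (Fin d)) 1) < ⊤ := by
  obtain ⟨v, hv⟩ := exists_unit hd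
  have h1 := hemisphere_lt_top hd hv
  have h2 := hemisphere_lt_top hd (v := -v) (by simpa using hv)
  refine (measure_mono ?_).trans_lt ((measure_union_le _ _).trans_lt (ENNReal.add_lt_top.2 ⟨h1, h2⟩))
  intro x hx
  have hx : ‖x‖ = 1 := by simpa using hx
  rcases le_total ⟪v, x⟫ 0 with h | h
  · exact Or.inl ⟨hx, h⟩
  · exact Or.inr ⟨hx, by rw [inner_neg_left]; linarith⟩

lemma sphere_pos (hd : 3 ≤ d) :
    0 < μH[(d : ℝ) - 1] (Metric.sphere (0 : EuclideanSpace ℝ (Fin d)) 1) := by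
  obtain ⟨v, hv⟩ := exists_unit hd
  have hfr := finrank_orth hd hv
  have hd0 : (0 : ℝ) ≤ (d : ℝ) - 1 := by rw [← hfr]; positivity
  refine lt_of_lt_of_le ?_ (hausdorffMeasure_orthogonalProjectionOnto_le (𝕜 := ℝ) (ℝ ∙ v)ᗮ _ _ hd0)
  have hsub : Metric.ball (0 : (ℝ ∙ v)ᗮ) 1 ⊆ (ℝ ∙ v)ᗮ.orthogonalProjectionOnto ''
      (Metric.sphere (0 : EuclideanSpace ℝ (Fin d)) 1) := by
    intro w hw
    have hw : ‖w‖ < 1 := by simpa using hw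
    have hw' : ‖w‖ ^ 2 ≤ 1 := by nlinarith [norm_nonneg w]
    have hin : ⟪(w : EuclideanSpace ℝ (Fin d)), v⟫ = 0 := by
      rw [real_inner_comm]
      exact Submodule.mem_orthogonal_singleton_iff_inner_right.1 w.2
    refine ⟨(w : EuclideanSpace ℝ (Fin d)) + Real.sqrt (1 - ‖w‖ ^ 2) • v, ?_, ?_⟩
    · rw [mem_sphere_zero_iff_norm]
      have : ‖(w : EuclideanSpace ℝ (Fin d)) + Real.sqrt (1 - ‖w‖ ^ 2) • v‖ ^ 2 = 1 := by
        rw [norm_add_sq_real, inner_smul_right, hin, norm_smul, hv, mul_one, Real.norm_eq_abs, sq_abs,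
          Real.sq_sqrt (by linarith)]
        simp
      nlinarith [norm_nonneg ((w : EuclideanSpace ℝ (Fin d)) + Real.sqrt (1 - ‖w‖ ^ 2) • v)]
    · rw [map_add, map_smul, Submodule.orthogonalProjectionOnto_orthogonalComplement_singleton_eq_zero]
      simp
  refine lt_of_lt_of_le ?_ (measure_mono hsub)
  rw [← hfr]
  exact Metric.isOpen_ball.measure_pos _ ⟨0, by simp⟩

/-- The restricted normalized measure. -/
def sg (d : ℕ) : Measure (EuclideanSpace ℝ (Fin d)) :=
  (sphereMeasure d).restrict (Metric.sphere 0 1)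

lemma sg_univ (hd : 3 ≤ d) : sg d Set.univ = 1 := by
  rw [sg, Measure.restrict_apply_univ, sphereMeasure, Measure.smul_apply, smul_eq_mul]
  exact ENNReal.inv_mul_cancel (sphere_pos hd).ne' (sphere_lt_top hd).ne

lemma sg_prob (hd : 3 ≤ d) : IsProbabilityMeasure (sg d) := ⟨sg_univ hd⟩

lemma sg_ae : ∀ᵐ x ∂(sg d), ‖x‖ = 1 := by
  filter_upwards [ae_restrict_mem (Metric.isClosed_sphere.measurableSet)] with x hx
  simpa using hx

lemma sg_map (e : EuclideanSpace ℝ (Fin d) ≃ₗᵢ[ℝ] EuclideanSpace ℝ (Fin d)) :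
    MeasurePreserving e (sg d) (sg d) := by
  have h := (e.toIsometryEquiv.measurePreserving_hausdorffMeasure ((d : ℝ) - 1)).smul_measure
    (μH[(d : ℝ) - 1] (Metric.sphere (0 : EuclideanSpace ℝ (Fin d)) 1))⁻¹
  have h2 := h.restrict_preimage (s := Metric.sphere 0 1) Metric.isClosed_sphere.measurableSet
  have : e.toIsometryEquiv ⁻¹' (Metric.sphere 0 1) = Metric.sphere 0 1 := by
    ext x
    simp
  rw [this] at h2
  exact h2

lemma sg_integrable (hd : 3 ≤ d) {f : EuclideanSpace ℝ (Fin d) → ℝ} (hf : Continuous f) :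
    Integrable f (sg d) := by
  have := sg_prob hd
  obtain ⟨C, hC⟩ := (isCompact_sphere (0 : EuclideanSpace ℝ (Fin d)) 1).exists_bound_of_continuousOn
    hf.continuousOn
  refine Integrable.of_bound hf.aestronglyMeasurable C ?_
  filter_upwards [sg_ae] with x hx
  exact hC x (by simpa using hx)

end MeasurePart

section RotationPart

variable {d : ℕ}

lemma continuous_evalP (P : MvPolynomial (Fin d) ℝ) :
    Continuous (fun x : EuclideanSpace ℝ (Fin d) => eval (fun i => x i) P) := by
  have h : Continuous (fun x : EuclideanSpace ℝ (Fin d) => (fun i => x i : Fin d → ℝ)) := by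
    fun_prop
  exact (MvPolynomial.continuous_eval P).comp h

/-- The rotation in the `(i, j)` plane, as a function. -/
def rotFun (i j : Fin d) (s : ℝ) (x : EuclideanSpace ℝ (Fin d)) : EuclideanSpace ℝ (Fin d) :=
  x + ((Real.cos s - 1) * x i - Real.sin s * x j) • EuclideanSpace.single i (1 : ℝ)
    + (Real.sin s * x i + (Real.cos s - 1) * x j) • EuclideanSpace.single j (1 : ℝ)

lemma rotFun_norm {i j : Fin d} (hij : i ≠ j) (s : ℝ) (x : EuclideanSpace ℝ (Fin d)) :
    ‖rotFun i j s x‖ = ‖x‖ := by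
  have h : ‖rotFun i j s x‖ ^ 2 = ‖x‖ ^ 2 := by
    rw [rotFun, norm_add_sq_real, norm_add_sq_real, inner_add_left, inner_smul_right,
      inner_smul_right, inner_smul_left, inner_smul_right, norm_smul, norm_smul]
    simp [EuclideanSpace.inner_single_right, hij, hij.symm, mul_pow]
    have := Real.sin_sq_add_cos_sq s
    linear_combination (x i ^ 2 + x j ^ 2) * this
  exact (sq_eq_sq₀ (norm_nonneg _) (norm_nonneg _)).1 h

/-- The rotation in the `(i, j)` plane, as a linear isometry equivalence. -/
def rot {i j : Fin d} (hij : i ≠ j) (s : ℝ) :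
    EuclideanSpace ℝ (Fin d) ≃ₗᵢ[ℝ] EuclideanSpace ℝ (Fin d) :=
  LinearIsometry.toLinearIsometryEquiv
    { toFun := rotFun i j s
      map_add' := by
        intro x y
        ext k
        simp [rotFun]
        split_ifs <;> ring
      map_smul' := by
        intro c x
        ext k
        simp [rotFun]
        split_ifs <;> ring
      norm_map' := rotFun_norm hij s } rfl

lemma rot_apply {i j : Fin d} (hij : i ≠ j) (s : ℝ) (x : EuclideanSpace ℝ (Fin d)) :
    rot hij s x = rotFun i j s x := rfl

lemma hasDerivAt_eval (g g' : ℝ → Fin d → ℝ) (s : ℝ)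
    (hg : ∀ k, HasDerivAt (fun s => g s k) (g' s k) s) (P : MvPolynomial (Fin d) ℝ) :
    HasDerivAt (fun s => eval (g s) P) (∑ k, g' s k * eval (g s) (pderiv k P)) s := by
  induction P using MvPolynomial.induction_on with
  | C a => simpa using hasDerivAt_const s a
  | add p q hp hq =>
    simp only [map_add, mul_add, Finset.sum_add_distrib]
    exact hp.add hq
  | mul_X p n hp =>
    have h := hp.mul (hg n)
    simp only [map_mul, eval_X]
    convert! h using 1
    simp only [Derivation.leibniz, smul_eq_mul, pderiv_X, map_add, map_mul, eval_X, mul_add,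
      Finset.sum_add_distrib, Finset.sum_mul]
    rw [add_comm]
    congr 1
    · refine Finset.sum_congr rfl fun k _ => by ring
    · rw [Finset.sum_eq_single n]
      · simp
        ring
      · intro b _ hb
        simp [Pi.single_apply, hb.symm, hb]
      · simp

/-- The rotation generator. -/
def gen (i j : Fin d) (P : MvPolynomial (Fin d) ℝ) : MvPolynomial (Fin d) ℝ :=
  X i * pderiv j P - X j * pderiv i P

lemma hasDerivAt_rot {i j : Fin d} (hij : i ≠ j) (P : MvPolynomial (Fin d) ℝ)
    (x : EuclideanSpace ℝ (Fin d)) (s : ℝ) :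
    HasDerivAt (fun s => eval (fun k => rotFun i j s x k) P)
      (eval (fun k => rotFun i j s x k) (gen i j P)) s := by
  have h := hasDerivAt_eval (fun s k => rotFun i j s x k)
    (fun s k => (-Real.sin s * x i - Real.cos s * x j) * (if k = i then 1 else 0)
      + (Real.cos s * x i - Real.sin s * x j) * (if k = j then 1 else 0)) s ?_ P
  · convert! h using 1
    simp only [add_mul, Finset.sum_add_distrib, mul_assoc, ite_mul, one_mul, zero_mul, mul_ite,
      mul_zero, Finset.sum_ite_eq', Finset.mem_univ, if_true]
    simp [gen, rotFun, hij, hij.symm]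
    ring
  · intro k
    have hc := Real.hasDerivAt_cos s
    have hs := Real.hasDerivAt_sin s
    have h1 := (((hc.sub_const 1).mul_const (x i)).sub (hs.mul_const (x j))).mul_const
      (if k = i then (1 : ℝ) else 0)
    have h2 := ((hs.mul_const (x i)).add ((hc.sub_const 1).mul_const (x j))).mul_const
      (if k = j then (1 : ℝ) else 0)
    have h3 := (h1.const_add (x k)).add h2
    convert! h3 using 1
    · ext s
      simp [rotFun, Pi.single_apply]
    · ring

lemma continuous_rot (i j : Fin d) (P : MvPolynomial (Fin d) ℝ) :
    Continuous (fun z : ℝ × EuclideanSpace ℝ (Fin d) =>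
      eval (fun k => rotFun i j z.1 z.2 k) P) := by
  have h : Continuous (fun z : ℝ × EuclideanSpace ℝ (Fin d) => rotFun i j z.1 z.2) := by
    unfold rotFun
    fun_prop
  exact (continuous_evalP P).comp h

lemma continuous_rot_right (i j : Fin d) (s : ℝ) (P : MvPolynomial (Fin d) ℝ) :
    Continuous (fun x : EuclideanSpace ℝ (Fin d) => eval (fun k => rotFun i j s x k) P) := by
  have h : Continuous (fun x : EuclideanSpace ℝ (Fin d) => rotFun i j s x) := by
    unfold rotFun
    fun_prop
  exact (continuous_evalP P).comp h

lemma integral_rot {i j : Fin d} (hij : i ≠ j) (s : ℝ) (P : MvPolynomial (Fin d) ℝ) :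
    ∫ x, eval (fun k => rotFun i j s x k) P ∂(sg d) = ∫ x, eval (fun k => x k) P ∂(sg d) :=
  (sg_map (rot hij s)).integral_comp' (f := (rot hij s).toHomeomorph.toMeasurableEquiv)
    (fun x => eval (fun k => x k) P)

lemma integral_gen (hd : 3 ≤ d) (i j : Fin d) (P : MvPolynomial (Fin d) ℝ) :
    ∫ x, eval (fun k => x k) (gen i j P) ∂(sg d) = 0 := by
  by_cases hij : i = j
  · subst hij
    simp [gen]
  have := sg_prob hd
  have hFTC : ∀ x : EuclideanSpace ℝ (Fin d),
      ∫ s in (0 : ℝ)..1, eval (fun k => rotFun i j s x k) (gen i j P) =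
        eval (fun k => rotFun i j 1 x k) P - eval (fun k => rotFun i j 0 x k) P := by
    intro x
    refine intervalIntegral.integral_eq_sub_of_hasDerivAt (fun s _ => hasDerivAt_rot hij P x s) ?_
    exact ((continuous_rot i j (gen i j P)).comp
      (by fun_prop : Continuous fun s : ℝ => (s, x))).intervalIntegrable _ _
  have hsw : ∫ s in (0 : ℝ)..1, ∫ x, eval (fun k => rotFun i j s x k) (gen i j P) ∂(sg d)
      = ∫ x, (∫ s in (0 : ℝ)..1, eval (fun k => rotFun i j s x k) (gen i j P)) ∂(sg d) := by
    refine intervalIntegral_integral_swap ?_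
    have hcont := continuous_rot i j (gen i j P)
    obtain ⟨C, hC⟩ := (isCompact_Icc (a := (0 : ℝ)) (b := 1)).prod
      (isCompact_sphere (0 : EuclideanSpace ℝ (Fin d)) 1) |>.exists_bound_of_continuousOn
        hcont.continuousOn
    have hfin : IsFiniteMeasure (volume.restrict (Set.uIoc (0 : ℝ) 1)) := by
      constructor
      simp
    refine Integrable.of_bound hcont.aestronglyMeasurable C ?_
    have h1 : ∀ᵐ z ∂((volume.restrict (Set.uIoc (0 : ℝ) 1)).prod (sg d)),
        z.1 ∈ Set.uIoc (0 : ℝ) 1 :=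
      Measure.quasiMeasurePreserving_fst.ae (ae_restrict_mem measurableSet_uIoc)
    have h2 : ∀ᵐ z ∂((volume.restrict (Set.uIoc (0 : ℝ) 1)).prod (sg d)), ‖z.2‖ = 1 :=
      Measure.quasiMeasurePreserving_snd.ae sg_ae
    filter_upwards [h1, h2] with z hz1 hz2
    refine hC z ⟨?_, by simpa using hz2⟩
    rw [Set.uIoc_of_le zero_le_one] at hz1
    exact ⟨hz1.1.le, hz1.2⟩
  simp only [hFTC, integral_rot hij] at hsw
  rw [integral_sub, integral_rot hij, integral_rot hij] at hsw
  · simpa using hsw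
  · exact sg_integrable hd (continuous_rot_right i j 1 P)
  · exact sg_integrable hd (continuous_rot_right i j 0 P)

/-- Integration of polynomials over the sphere, as a linear functional. -/
def II (hd : 3 ≤ d) : MvPolynomial (Fin d) ℝ →ₗ[ℝ] ℝ where
  toFun P := ∫ x, eval (fun k => x k) P ∂(sg d)
  map_add' P Q := by
    simp only [map_add]
    exact integral_add (sg_integrable hd (continuous_evalP P)) (sg_integrable hd (continuous_evalP Q))
  map_smul' c P := by
    simp only [smul_eval, RingHom.id_apply, smul_eq_mul]
    exact integral_const_mul _ _

lemma II_apply (hd : 3 ≤ d) (P : MvPolynomial (Fin d) ℝ) :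
    II hd P = ∫ x, eval (fun k => x k) P ∂(sg d) := rfl

lemma II_C (hd : 3 ≤ d) (c : ℝ) : II hd (C c) = c := by
  have := sg_prob hd
  simp [II_apply]

lemma II_gen (hd : 3 ≤ d) (i j : Fin d) (P : MvPolynomial (Fin d) ℝ) :
    II hd (X i * pderiv j P) = II hd (X j * pderiv i P) := by
  have h := integral_gen hd i j P
  rw [← II_apply hd, gen, map_sub] at h
  linarith

lemma II_sq (hd : 3 ≤ d) (P : MvPolynomial (Fin d) ℝ) :
    II hd ((∑ i, X i * X i) * P) = II hd P := by
  rw [II_apply, II_apply]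
  refine integral_congr_ae ?_
  filter_upwards [sg_ae] with x hx
  have h : ∑ i, x i * x i = 1 := by
    have := EuclideanSpace.real_norm_sq_eq x
    rw [hx] at this
    simp only [← pow_two]
    rw [← this]
    norm_num
  simp [h]

end RotationPart

section AlgebraPart

variable {d : ℕ}

lemma key_X (hd : 3 ≤ d) (j : Fin d) {Q : MvPolynomial (Fin d) ℝ} {k : ℕ}
    (hQ : Q.IsHomogeneous k) :
    ((d : ℝ) + k - 1) * II hd (X j * Q) = II hd (pderiv j Q) := by
  have h1 : ∀ i, II hd (X i * pderiv j (X i * Q)) = II hd (X j * pderiv i (X i * Q)) :=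
    fun i => II_gen hd i j _
  have h2 : ∑ i, X i * pderiv j (X i * Q) = (∑ i, X i * X i) * pderiv j Q + X j * Q := by
    simp only [Derivation.leibniz, smul_eq_mul, pderiv_X, mul_add, Finset.sum_add_distrib,
      Finset.sum_mul]
    congr 1
    · exact Finset.sum_congr rfl fun i _ => by ring
    · rw [Finset.sum_eq_single j]
      · simp
      · intro b _ hb
        simp [hb]
      · simp
  have h3 : ∑ i, X j * pderiv i (X i * Q) = ((d : ℝ) + k) • (X j * Q) := by
    have he := hQ.sum_X_mul_pderiv
    simp only [Derivation.leibniz, smul_eq_mul, pderiv_X_self, mul_add, Finset.sum_add_distrib,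
      ← Finset.mul_sum, he]
    simp [MvPolynomial.smul_eq_C_mul]
    ring
  have h4 := congrArg (II hd) h2
  have h5 := congrArg (II hd) h3
  rw [map_sum] at h4 h5
  rw [Finset.sum_congr rfl fun i _ => h1 i, h5, map_add, II_sq, map_smul, smul_eq_mul] at h4
  linarith

/-- The linear form `(x|η)`. -/
def lin (η : Fin d → ℝ) : MvPolynomial (Fin d) ℝ := ∑ i, C (η i) * X i

/-- The directional derivative. -/
def dir (η : Fin d → ℝ) (P : MvPolynomial (Fin d) ℝ) : MvPolynomial (Fin d) ℝ :=
  ∑ i, C (η i) * pderiv i P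

lemma key_lin (hd : 3 ≤ d) (η : Fin d → ℝ) {Q : MvPolynomial (Fin d) ℝ} {k : ℕ}
    (hQ : Q.IsHomogeneous k) :
    ((d : ℝ) + k - 1) * II hd (lin η * Q) = II hd (dir η Q) := by
  simp only [lin, dir, Finset.sum_mul, map_sum, Finset.mul_sum]
  refine Finset.sum_congr rfl fun i _ => ?_
  rw [mul_assoc, ← smul_eq_C_mul, ← smul_eq_C_mul, map_smul, map_smul, ← key_X hd i hQ]
  simp only [smul_eq_mul]
  ring

lemma dir_mul (η : Fin d → ℝ) (P Q : MvPolynomial (Fin d) ℝ) :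
    dir η (P * Q) = P * dir η Q + dir η P * Q := by
  simp only [dir, Derivation.leibniz, smul_eq_mul, mul_add, Finset.sum_add_distrib,
    Finset.mul_sum, Finset.sum_mul]
  congr 1 <;> exact Finset.sum_congr rfl fun i _ => by ring

lemma dir_lin (η : Fin d → ℝ) (hη : ∑ i, η i * η i = 1) : dir η (lin η) = 1 := by
  have h : ∀ i, pderiv i (lin η) = C (η i) := by
    intro i
    simp only [lin, map_sum, Derivation.leibniz, smul_eq_mul, pderiv_C, pderiv_X, mul_zero, add_zero]
    rw [Finset.sum_eq_single i]
    · simp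
    · intro b _ hb
      simp [hb]
    · simp
  simp only [dir, h, ← C_mul, ← map_sum, hη, C_1]

lemma dir_lin_pow (η : Fin d → ℝ) (hη : ∑ i, η i * η i = 1) (k : ℕ) :
    dir η (lin η ^ k) = C (k : ℝ) * lin η ^ (k - 1) := by
  induction k with
  | zero => simp [dir]
  | succ k ih =>
    rw [pow_succ, dir_mul, ih, dir_lin η hη]
    rcases k with _ | k
    · simp
    · simp [pow_succ]
      ring

lemma lin_hom (η : Fin d → ℝ) : (lin η).IsHomogeneous 1 := by
  refine IsHomogeneous.sum _ _ _ fun i _ => ?_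
  simpa using (isHomogeneous_C (Fin d) (η i)).mul (isHomogeneous_X ℝ i)

lemma dir_hom (η : Fin d → ℝ) {P : MvPolynomial (Fin d) ℝ} {l : ℕ} (hP : P.IsHomogeneous l) :
    (dir η P).IsHomogeneous (l - 1) := by
  refine IsHomogeneous.sum _ _ _ fun i _ => ?_
  simpa using (isHomogeneous_C (Fin d) (η i)).mul (hP.pderiv (i := i))

lemma pderiv_comm' (i j : Fin d) (P : MvPolynomial (Fin d) ℝ) :
    pderiv i (pderiv j P) = pderiv j (pderiv i P) := by
  have h : ⁅(pderiv i : Derivation ℝ (MvPolynomial (Fin d) ℝ) (MvPolynomial (Fin d) ℝ)),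
      (pderiv j : Derivation ℝ (MvPolynomial (Fin d) ℝ) (MvPolynomial (Fin d) ℝ))⁆ = 0 := by
    refine MvPolynomial.derivation_ext fun k => ?_
    simp only [Derivation.commutator_apply, pderiv_X, Derivation.zero_apply, Pi.single_apply]
    split_ifs <;> simp
  have h2 := congrArg (fun D => D P) h
  simp only [Derivation.commutator_apply, Derivation.zero_apply] at h2
  exact sub_eq_zero.1 h2

lemma lap_dir (η : Fin d → ℝ) {P : MvPolynomial (Fin d) ℝ} (hP : lap P = 0) :
    lap (dir η P) = 0 := by
  have : lap (dir η P) = dir η (lap P) := by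
    simp only [lap, dir, map_sum, Finset.mul_sum, Derivation.leibniz, smul_eq_mul, pderiv_C,
      mul_zero, add_zero]
    rw [Finset.sum_comm]
    refine Finset.sum_congr rfl fun i _ => Finset.sum_congr rfl fun j _ => ?_
    rw [pderiv_comm' j i P, pderiv_comm' j i]
  rw [this, hP]
  simp [dir]

lemma step (hd : 3 ≤ d) (η : Fin d → ℝ) (hη : ∑ i, η i * η i = 1)
    {P : MvPolynomial (Fin d) ℝ} {l : ℕ} (hP : P.IsHomogeneous l) (k : ℕ) :
    ((d : ℝ) + k + l - 1) * II hd (lin η ^ (k + 1) * P) =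
      k * II hd (lin η ^ (k - 1) * P) + II hd (lin η ^ k * dir η P) := by
  have hQ : (lin η ^ k * P).IsHomogeneous (k + l) := by
    simpa using ((lin_hom η).pow k).mul hP
  have h := key_lin hd η hQ
  rw [dir_mul, dir_lin_pow η hη, map_add, ← mul_assoc, ← pow_succ', mul_assoc, ← smul_eq_C_mul,
    map_smul, smul_eq_mul] at h
  push_cast at h
  linarith

lemma mean_zero (hd : 3 ≤ d) {P : MvPolynomial (Fin d) ℝ} {l : ℕ} (hl : 0 < l)
    (hP : P.IsHomogeneous l) (hh : lap P = 0) : II hd P = 0 := by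
  have he := congrArg (II hd) hP.sum_X_mul_pderiv
  have h1 : ((d : ℝ) + (l - 1 : ℕ) - 1) * ∑ i, II hd (X i * pderiv i P) = 0 := by
    rw [Finset.mul_sum, Finset.sum_congr rfl fun i _ => key_X hd i (hP.pderiv (i := i)), ← map_sum]
    change II hd (lap P) = 0
    rw [hh, map_zero]
  have h2 : ((d : ℝ) + (l - 1 : ℕ) - 1) ≠ 0 := by
    have : (3 : ℝ) ≤ d := by exact_mod_cast hd
    have : (0 : ℝ) ≤ ((l - 1 : ℕ) : ℝ) := by positivity
    linarith
  rw [map_sum, (mul_eq_zero.1 h1).resolve_left h2, map_nsmul, nsmul_eq_mul] at he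
  have h3 : (l : ℝ) ≠ 0 := by positivity
  exact (mul_eq_zero.1 he.symm).resolve_left h3

lemma vanish (hd : 3 ≤ d) (η : Fin d → ℝ) (hη : ∑ i, η i * η i = 1) (k : ℕ) :
    ∀ (l : ℕ) (P : MvPolynomial (Fin d) ℝ), k < l → P.IsHomogeneous l → lap P = 0 →
      II hd (lin η ^ k * P) = 0 := by
  induction k using Nat.strong_induction_on with
  | _ k ih =>
    intro l P hkl hP hh
    rcases k with _ | k
    · simpa using mean_zero hd hkl hP hh
    · have h := step hd η hη hP k
      have h1 : (k : ℝ) * II hd (lin η ^ (k - 1) * P) = 0 := by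
        rcases k with _ | k
        · simp
        · rw [ih (k + 1 - 1) (by omega) l P (by omega) hP hh, mul_zero]
      rw [h1, ih k (by omega) (l - 1) (dir η P) (by omega) (dir_hom η hP) (lap_dir η hh),
        add_zero] at h
      have h2 : ((d : ℝ) + k + l - 1) ≠ 0 := by
        have h3 : (3 : ℝ) ≤ d := by exact_mod_cast hd
        have h4 : (0 : ℝ) ≤ (k : ℝ) := by positivity
        have h5 : (0 : ℝ) ≤ (l : ℝ) := by positivity
        linarith
      exact (mul_eq_zero.1 h).resolve_left h2

lemma top_moment (hd : 3 ≤ d) (η : Fin d → ℝ) (hη : ∑ i, η i * η i = 1) (l : ℕ) :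
    ∀ (P : MvPolynomial (Fin d) ℝ), P.IsHomogeneous l → lap P = 0 →
      (∏ i ∈ Finset.range l, ((d : ℝ) + 2 * i)) * II hd (lin η ^ l * P) =
        (l.factorial : ℝ) * eval η P := by
  induction l with
  | zero =>
    intro P hP _
    rw [← totalDegree_zero_iff_isHomogeneous, totalDegree_eq_zero_iff_eq_C] at hP
    rw [hP]
    simp [II_C]
  | succ l ih =>
    intro P hP hh
    have h := step hd η hη hP l
    have h1 : (l : ℝ) * II hd (lin η ^ (l - 1) * P) = 0 := by
      rw [vanish hd η hη (l - 1) (l + 1) P (by omega) hP hh, mul_zero]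
    have h2 := ih (dir η P) (by simpa using dir_hom η hP) (lap_dir η hh)
    have h3 : eval η (dir η P) = ((l : ℝ) + 1) * eval η P := by
      have he := congrArg (eval η) hP.sum_X_mul_pderiv
      simpa [dir] using he
    rw [h1, zero_add] at h
    rw [Finset.prod_range_succ, Nat.factorial_succ]
    push_cast at h ⊢
    rw [h3, ← h] at h2
    linear_combination h2

end AlgebraPart

section GegenbauerPart

/-- The coefficient-like terms of the Gegenbauer polynomial at `1`. -/
def gt (a : ℝ) (m j : ℕ) : ℝ :=
  if 2 * j ≤ m then
    (-1) ^ j * (∏ i ∈ Finset.range (m - j), (a + i)) / (j.factorial * (m - 2 * j).factorial)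
      * 2 ^ (m - 2 * j)
  else 0

lemma Gamma_prod (a : ℝ) (ha : 0 < a) (n : ℕ) :
    Real.Gamma (a + n) = (∏ i ∈ Finset.range n, (a + i)) * Real.Gamma a := by
  induction n with
  | zero => simp
  | succ n ih =>
    have : a + (n : ℝ) ≠ 0 := by positivity
    rw [Finset.prod_range_succ]
    push_cast
    rw [← add_assoc, Real.Gamma_add_one this, ih]
    ring

lemma gegenbauer_one (a : ℝ) (ha : 0 < a) (m N : ℕ) (hN : m / 2 + 1 ≤ N) :
    gegenbauer a m 1 = ∑ j ∈ Finset.range N, gt a m j := by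
  have hsub : ∑ j ∈ Finset.range N, gt a m j = ∑ j ∈ Finset.range (m / 2 + 1), gt a m j := by
    symm
    refine Finset.sum_subset (Finset.range_mono hN) fun j _ hj => ?_
    rw [Finset.mem_range] at hj
    rw [gt, if_neg (by omega)]
  rw [hsub, gegenbauer]
  refine Finset.sum_congr rfl fun j hj => ?_
  rw [Finset.mem_range] at hj
  have h2 : 2 * j ≤ m := by omega
  rw [gt, if_pos h2]
  have e1 : a + (m : ℝ) - j = a + ((m - j : ℕ) : ℝ) := by
    rw [Nat.cast_sub (by omega)]
    ring
  have e2 : (m : ℝ) + 1 - 2 * j = ((m - 2 * j : ℕ) : ℝ) + 1 := by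
    rw [Nat.cast_sub h2]
    push_cast
    ring
  rw [e1, e2, Gamma_prod a ha, Real.Gamma_nat_eq_factorial, Real.Gamma_nat_eq_factorial]
  have := (Real.Gamma_pos_of_pos ha).ne'
  field_simp

lemma gt_rec_zero (a : ℝ) (m : ℕ) :
    ((m : ℝ) + 2) * gt a (m + 2) 0 = 2 * (m + 1 + a) * gt a (m + 1) 0 := by
  simp only [gt]
  simp [Finset.prod_range_succ, Nat.factorial_succ]
  have : (m.factorial : ℝ) ≠ 0 := by positivity
  field_simp
  ring

lemma gt_rec (a : ℝ) (m j : ℕ) :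
    ((m : ℝ) + 2) * gt a (m + 2) (j + 1) =
      2 * (m + 1 + a) * gt a (m + 1) (j + 1) - (m + 2 * a) * gt a m j := by
  by_cases h : 2 * j ≤ m
  · obtain ⟨q, rfl⟩ := Nat.exists_eq_add_of_le h
    rcases q with _ | q
    · simp only [gt]
      rw [if_pos (by omega), if_neg (by omega), if_pos (by omega)]
      have e1 : 2 * j + 0 + 2 - (j + 1) = j + 1 := by omega
      have e2 : 2 * j + 0 + 2 - 2 * (j + 1) = 0 := by omega
      have e3 : 2 * j + 0 - j = j := by omega
      have e4 : 2 * j + 0 - 2 * j = 0 := by omega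
      rw [e1, e2, e3, e4, Finset.prod_range_succ, Nat.factorial_succ]
      push_cast
      have : (j.factorial : ℝ) ≠ 0 := by positivity
      have : ((j : ℝ) + 1) ≠ 0 := by positivity
      field_simp
      ring
    · simp only [gt]
      rw [if_pos (by omega), if_pos (by omega), if_pos (by omega)]
      have e1 : 2 * j + (q + 1) + 2 - (j + 1) = j + q + 1 + 1 := by omega
      have e2 : 2 * j + (q + 1) + 2 - 2 * (j + 1) = q + 1 := by omega
      have e3 : 2 * j + (q + 1) - j = j + q + 1 := by omega
      have e4 : 2 * j + (q + 1) - 2 * j = q + 1 := by omega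
      have e5 : 2 * j + (q + 1) + 1 - (j + 1) = j + q + 1 := by omega
      have e6 : 2 * j + (q + 1) + 1 - 2 * (j + 1) = q := by omega
      rw [e1, e2, e3, e4, e5, e6, Finset.prod_range_succ _ (j + q + 1), Nat.factorial_succ j,
        Nat.factorial_succ q]
      push_cast
      have : (j.factorial : ℝ) ≠ 0 := by positivity
      have : (q.factorial : ℝ) ≠ 0 := by positivity
      have : ((j : ℝ) + 1) ≠ 0 := by positivity
      have : ((q : ℝ) + 1) ≠ 0 := by positivity
      field_simp
      ring
  · simp only [gt]
    rw [if_neg (by omega), if_neg (by omega), if_neg h]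
    ring

lemma gegenbauer_one_rec (a : ℝ) (ha : 0 < a) (m : ℕ) :
    ((m : ℝ) + 2) * gegenbauer a (m + 2) 1 =
      2 * (m + 1 + a) * gegenbauer a (m + 1) 1 - (m + 2 * a) * gegenbauer a m 1 := by
  rw [gegenbauer_one a ha (m + 2) (m + 3) (by omega), gegenbauer_one a ha (m + 1) (m + 3) (by omega),
    gegenbauer_one a ha m (m + 2) (by omega), Finset.sum_range_succ', Finset.sum_range_succ' (gt a (m + 1)),
    mul_add, mul_add, gt_rec_zero, Finset.mul_sum, Finset.sum_congr rfl fun j _ => gt_rec a m j,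
    Finset.sum_sub_distrib, ← Finset.mul_sum, ← Finset.mul_sum]
  ring

lemma gegenbauer_one_eq (a : ℝ) (ha : 0 < a) (m : ℕ) :
    gegenbauer a m 1 = (∏ i ∈ Finset.range m, (2 * a + i)) / m.factorial := by
  induction m using Nat.twoStepInduction with
  | zero =>
    rw [gegenbauer_one a ha 0 1 (by omega)]
    simp [gt]
  | one =>
    rw [gegenbauer_one a ha 1 1 (by omega)]
    simp [gt]
    ring
  | more m h1 h2 =>
    have h := gegenbauer_one_rec a ha m
    rw [h1, h2] at h
    have h0 : (m : ℝ) + 2 ≠ 0 := by positivity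
    refine mul_left_cancel₀ h0 (h.trans ?_)
    simp only [Finset.prod_range_succ, Nat.factorial_succ]
    push_cast
    have : (m.factorial : ℝ) ≠ 0 := by positivity
    have : ((m : ℝ) + 1) ≠ 0 := by positivity
    have : ((m : ℝ) + 1 + 1) ≠ 0 := by positivity
    field_simp
    ring

end GegenbauerPart

/-- **Reproducing kernel property of `Z^l_η(ξ) = C^α_l((ξ|η))/C^α_l(1)` (d ≥ 3, α = (d-2)/2).**
For every harmonic homogeneous polynomial `P` of degree `l`,
`dim ℋ^l · ∫_{S^{d-1}} Z^l_η(ξ) P(ξ) dσ(ξ) = P(η)` where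
`dim ℋ^l = 2(l+α)Γ(2α+l)/(Γ(l+1)Γ(2α+1))`. -/
theorem reproducing_kernel (d l : ℕ) (hd : 3 ≤ d)
    (α : ℝ) (hα : α = ((d : ℝ) - 2) / 2)
    (η : EuclideanSpace ℝ (Fin d)) (hη : ‖η‖ = 1)
    (P : MvPolynomial (Fin d) ℝ) (hP : P.IsHomogeneous l) (hharm : lap P = 0) :
    (2 * ((l : ℝ) + α) * Real.Gamma (2 * α + l) /
        (Real.Gamma ((l : ℝ) + 1) * Real.Gamma (2 * α + 1))) *
      ∫ ξ in Metric.sphere (0 : EuclideanSpace ℝ (Fin d)) 1,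
        (gegenbauer α l ⟪ξ, η⟫ / gegenbauer α l 1) * eval (fun i => ξ i) P
        ∂(sphereMeasure d) =
      eval (fun i => η i) P := by
  have ha : 0 < α := by
    have : (3 : ℝ) ≤ d := by exact_mod_cast hd
    rw [hα]
    linarith
  have hdα : (d : ℝ) = 2 * (α + 1) := by
    rw [hα]
    ring
  have hηs : ∑ i, η i * η i = 1 := by
    have := EuclideanSpace.real_norm_sq_eq η
    rw [hη] at this
    simp only [← pow_two]
    rw [← this]
    norm_num
  have hlin : ∀ ξ : EuclideanSpace ℝ (Fin d),
      eval (fun i => ξ i) (lin (fun i => η i)) = ⟪ξ, η⟫ := by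
    intro ξ
    simp [lin, PiLp.inner_apply]
  -- the coefficients
  set c : ℕ → ℝ := fun j => (-1) ^ j * Real.Gamma (α + l - j) /
      (Real.Gamma α * Real.Gamma (j + 1) * Real.Gamma ((l : ℝ) + 1 - 2 * j)) * 2 ^ (l - 2 * j) with hc
  have hint : ∫ ξ in Metric.sphere (0 : EuclideanSpace ℝ (Fin d)) 1,
        (gegenbauer α l ⟪ξ, η⟫ / gegenbauer α l 1) * eval (fun i => ξ i) P ∂(sphereMeasure d) =
      (gegenbauer α l 1)⁻¹ * II hd (∑ j ∈ Finset.range (l / 2 + 1),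
        c j • (lin (fun i => η i) ^ (l - 2 * j) * P)) := by
    rw [II_apply, ← integral_const_mul]
    change ∫ ξ, _ ∂(sg d) = _
    refine integral_congr_ae (Filter.Eventually.of_forall fun ξ => ?_)
    simp only [map_sum, smul_eval, map_mul, map_pow, hlin]
    rw [gegenbauer, div_eq_inv_mul, mul_assoc, Finset.sum_mul]
    congr 1
    refine Finset.sum_congr rfl fun j _ => ?_
    rw [hc, mul_pow]
    ring
  have hsum : II hd (∑ j ∈ Finset.range (l / 2 + 1),
        c j • (lin (fun i => η i) ^ (l - 2 * j) * P)) = c 0 * II hd (lin (fun i => η i) ^ l * P) := by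
    rw [map_sum, Finset.sum_eq_single 0]
    · simp
    · intro j hj hj0
      rw [Finset.mem_range] at hj
      rw [map_smul, vanish hd _ hηs (l - 2 * j) l P (by omega) hP hharm, smul_zero]
    · simp
  have htop := top_moment hd _ hηs l P hP hharm
  have hc0 : c 0 = (∏ i ∈ Finset.range l, (α + i)) / l.factorial * 2 ^ l := by
    have h1 := Gamma_prod α ha l
    have h2 := (Real.Gamma_pos_of_pos ha).ne'
    simp only [hc]
    simp only [Nat.cast_zero, sub_zero, mul_zero, pow_zero, one_mul, zero_add, Real.Gamma_one,
      mul_one, Nat.sub_zero, Real.Gamma_nat_eq_factorial, h1]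
    field_simp
  have hprod : ∏ i ∈ Finset.range l, ((d : ℝ) + 2 * i) =
      2 ^ l * ∏ i ∈ Finset.range l, (α + 1 + i) := by
    rw [hdα, ← Finset.card_range l, ← Finset.prod_const, Finset.card_range,
      ← Finset.prod_mul_distrib]
    exact Finset.prod_congr rfl fun i _ => by ring
  have hshift : α * ∏ i ∈ Finset.range l, (α + 1 + i) =
      (∏ i ∈ Finset.range l, (α + i)) * (α + l) := by
    rw [← Finset.prod_range_succ (fun i : ℕ => α + (i : ℝ)), Finset.prod_range_succ', mul_comm]
    simp only [Nat.cast_zero, add_zero]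
    congr 1
    exact Finset.prod_congr rfl fun i _ => by push_cast; ring
  have hA : 0 < ∏ i ∈ Finset.range l, (α + i) := Finset.prod_pos fun i _ => by positivity
  have hB : 0 < ∏ i ∈ Finset.range l, (α + 1 + i) := Finset.prod_pos fun i _ => by positivity
  have hG : 0 < ∏ i ∈ Finset.range l, (2 * α + i) := Finset.prod_pos fun i _ => by positivity
  have hG2 : 0 < Real.Gamma (2 * α) := Real.Gamma_pos_of_pos (by positivity)
  rw [hint, hsum, hc0, gegenbauer_one_eq α ha, Gamma_prod (2 * α) (by positivity),
    Real.Gamma_nat_eq_factorial, Real.Gamma_add_one (by positivity)]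
  rw [hprod] at htop
  generalize (∏ i ∈ Finset.range l, (α + (i : ℝ))) = A at *
  generalize (∏ i ∈ Finset.range l, (α + 1 + (i : ℝ))) = B at *
  generalize (∏ i ∈ Finset.range l, (2 * α + (i : ℝ))) = G at *
  generalize II hd (lin (fun i => η i) ^ l * P) = J at *
  have hf : (0 : ℝ) < l.factorial := by positivity
  have hJ : A * (α + l) * 2 ^ l * J = α * (l.factorial * eval (fun i => η i) P) := by
    rw [← htop, ← hshift]
    ring
  generalize eval (fun i => η i) P = E at *
  field_simp
  linear_combination hJ

end
end

section
/- Let d ≥ 3, α = (d-2)/2, η ∈ S^{d-1}, and suppose φ : [-1,1] → ℂ has a Taylor expansion φ(t) = Σ_{m=0}^∞ (φ^{(m)}(0)/m!) t^m that converges absolutely on the closed interval [-1,1]. Let f(ξ) = φ((ξ|η)) be the corresponding zonal function on S^{d-1}. Then f has the spherical Fourier expansion f(ξ) = Γ(α+1) Σ_{m=0}^∞ f_m (dim ℋ^m) Z^m_η(ξ), where f_m = Σ_{k=0}^∞ φ^{(m+2k)}(0)/(2^{m+2k} k! Γ(α+m+k+1)), Z^m_η(ξ) = C^α_m((ξ|η))/C^α_m(1),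 and dim ℋ^m = 2(m+α)Γ(2α+m)/(Γ(m+1)Γ(2α+1)). -/
open MeasureTheory Finset
open scoped RealInnerProductSpace

noncomputable section

/-- The zonal (reproducing) kernel `Z^m_η(ξ) = C^α_m((ξ|η))/C^α_m(1)`. -/
def zonalKernel (d : ℕ) (α : ℝ) (m : ℕ) (η ξ : EuclideanSpace ℝ (Fin d)) : ℝ :=
  gegenbauer α m ⟪ξ, η⟫ / gegenbauer α m 1

/-- `dim ℋ^m = 2(m+α)Γ(2α+m)/(Γ(m+1)Γ(2α+1))`, the dimension of the space of harmonic
homogeneous polynomials of degree `m` on `ℝ^d` with `α = (d-2)/2`. -/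
def dimHarmonic (α : ℝ) (m : ℕ) : ℝ :=
  2 * ((m : ℝ) + α) * Real.Gamma (2 * α + m) /
    (Real.Gamma ((m : ℝ) + 1) * Real.Gamma (2 * α + 1))

/-- The `j`-th term of the Gegenbauer polynomial, extended by zero. -/
def gegTerm (α : ℝ) (t : ℝ) (m j : ℕ) : ℝ :=
  if 2 * j ≤ m then (-1) ^ j * Real.Gamma (α + m - j) /
      (Real.Gamma α * j.factorial * (m - 2 * j).factorial) * (2 * t) ^ (m - 2 * j) else 0

lemma gegenbauer_eq (α t : ℝ) (m N : ℕ) (hN : m / 2 < N) :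
    gegenbauer α m t = ∑ j ∈ Finset.range N, gegTerm α t m j := by
  unfold gegenbauer
  have hsub : Finset.range (m / 2 + 1) ⊆ Finset.range N := by
    intro x hx
    simp only [Finset.mem_range] at *
    omega
  rw [← Finset.sum_subset hsub (f := gegTerm α t m)]
  · apply Finset.sum_congr rfl
    intro j hj
    have hj' : 2 * j ≤ m := by
      simp only [Finset.mem_range] at hj
      omega
    have h1 : Real.Gamma ((m : ℝ) + 1 - 2 * j) = (m - 2 * j).factorial := by
      rw [← Real.Gamma_nat_eq_factorial]
      congr 1
      push_cast [Nat.cast_sub hj']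
      ring
    rw [gegTerm, if_pos hj', h1, Real.Gamma_nat_eq_factorial]
  · intro j _ hj
    rw [gegTerm, if_neg]
    simp only [Finset.mem_range] at hj
    omega

lemma gegTerm_rec_zero (α t : ℝ) (hα : 0 < α) (m : ℕ) :
    ((m : ℝ) + 2) * gegTerm α t (m + 2) 0 = (m + 1 + α) * (2 * t) * gegTerm α t (m + 1) 0 := by
  have hG : Real.Gamma (α + m + 2) = (α + m + 1) * Real.Gamma (α + m + 1) := by
    rw [← Real.Gamma_add_one (by positivity)]
    congr 1
    ring
  have hΓ := (Real.Gamma_pos_of_pos hα).ne'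
  simp only [gegTerm, mul_zero, Nat.zero_le, if_true, Nat.sub_zero, Nat.factorial_succ]
  push_cast
  simp only [sub_zero]
  rw [show α + ((m : ℝ) + 2) = α + m + 2 by ring, show α + ((m : ℝ) + 1) = α + m + 1 by ring, hG]
  have := Nat.factorial_ne_zero m
  field_simp
  ring

lemma gegTerm_rec_succ (α t : ℝ) (hα : 0 < α) (m j : ℕ) :
    ((m : ℝ) + 2) * gegTerm α t (m + 2) (j + 1) =
      (m + 1 + α) * (2 * t) * gegTerm α t (m + 1) (j + 1) - (m + 2 * α) * gegTerm α t m j := by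
  have hΓ := (Real.Gamma_pos_of_pos hα).ne'
  rcases lt_or_ge m (2 * j) with h | h
  · simp only [gegTerm]
    rw [if_neg (by omega), if_neg (by omega), if_neg (by omega)]
    ring
  obtain ⟨r, rfl⟩ := Nat.exists_eq_add_of_le h
  have hG : Real.Gamma (α + j + r + 1) = (α + j + r) * Real.Gamma (α + j + r) := by
    rw [← Real.Gamma_add_one (by positivity)]
  have hj := Nat.factorial_ne_zero j
  rcases r with _ | r
  · simp only [gegTerm]
    rw [if_pos (by omega), if_neg (by omega), if_pos (by omega)]
    rw [show 2 * j + 0 + 2 - 2 * (j + 1) = 0 by omega, show 2 * j + 0 - 2 * j = 0 by omega]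
    push_cast
    rw [show α + (2 * (j : ℝ) + 0 + 2) - (j + 1) = α + j + (0 : ℕ) + 1 by push_cast; ring, hG,
      show α + (2 * (j : ℝ) + 0) - j = α + j + (0 : ℕ) by push_cast; ring]
    simp only [Nat.factorial_succ, Nat.factorial_zero]
    push_cast
    field_simp
    ring
  · simp only [gegTerm]
    rw [if_pos (by omega), if_pos (by omega), if_pos (by omega)]
    rw [show 2 * j + (r + 1) + 2 - 2 * (j + 1) = r + 1 by omega,
      show 2 * j + (r + 1) + 1 - 2 * (j + 1) = r by omega,
      show 2 * j + (r + 1) - 2 * j = r + 1 by omega]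
    push_cast at hG ⊢
    rw [show α + (2 * (j : ℝ) + (r + 1) + 2) - (j + 1) = α + j + (r + 1) + 1 by ring, hG,
      show α + (2 * (j : ℝ) + (r + 1) + 1) - (j + 1) = α + j + (r + 1) by ring,
      show α + (2 * (j : ℝ) + (r + 1)) - j = α + j + (r + 1) by ring]
    simp only [Nat.factorial_succ]
    push_cast
    have := Nat.factorial_ne_zero r
    field_simp
    ring

lemma geg_rec (α t : ℝ) (hα : 0 < α) (m : ℕ) :
    ((m : ℝ) + 2) * gegenbauer α (m + 2) t =
      (m + 1 + α) * (2 * t) * gegenbauer α (m + 1) t - (m + 2 * α) * gegenbauer α m t := by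
  rw [gegenbauer_eq α t (m + 2) (m + 2 + 1) (by omega),
    gegenbauer_eq α t (m + 1) (m + 2 + 1) (by omega), gegenbauer_eq α t m (m + 2) (by omega),
    Finset.sum_range_succ', Finset.sum_range_succ' (gegTerm α t (m + 1))]
  rw [mul_add, mul_add, gegTerm_rec_zero α t hα, Finset.mul_sum, Finset.mul_sum, Finset.mul_sum]
  simp only [gegTerm_rec_succ α t hα, Finset.sum_sub_distrib]
  ring

lemma geg_zero (α t : ℝ) (hα : 0 < α) : gegenbauer α 0 t = 1 := by
  have hΓ := (Real.Gamma_pos_of_pos hα).ne'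
  simp [gegenbauer, hΓ]

lemma geg_one (α t : ℝ) (hα : 0 < α) : gegenbauer α 1 t = 2 * α * t := by
  have hΓ := (Real.Gamma_pos_of_pos hα).ne'
  rw [gegenbauer_eq α t 1 1 (by norm_num)]
  simp [gegTerm, Real.Gamma_add_one hα.ne']
  field_simp

lemma geg_at_one (α : ℝ) (hα : 0 < α) (m : ℕ) :
    gegenbauer α m 1 = Real.Gamma (2 * α + m) / (Real.Gamma (2 * α) * m.factorial) := by
  have h2 : 0 < 2 * α := by positivity
  have hΓ := (Real.Gamma_pos_of_pos h2).ne'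
  induction m using Nat.twoStepInduction with
  | zero => rw [geg_zero α 1 hα]; simp [hΓ]
  | one =>
    rw [geg_one α 1 hα]
    push_cast
    rw [Real.Gamma_add_one h2.ne']
    simp
    field_simp
  | more m ih1 ih2 =>
    have h := geg_rec α 1 hα m
    rw [ih1, ih2] at h
    have e1 : Real.Gamma (2 * α + m + 1) = (2 * α + m) * Real.Gamma (2 * α + m) :=
      Real.Gamma_add_one (by positivity)
    have e2 : Real.Gamma (2 * α + m + 1 + 1) = (2 * α + m + 1) * Real.Gamma (2 * α + m + 1) :=
      Real.Gamma_add_one (by positivity)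
    have hm : ((m : ℝ) + 2) ≠ 0 := by positivity
    apply mul_left_cancel₀ hm
    rw [h]
    simp only [Nat.factorial_succ]
    push_cast
    rw [show 2 * α + ((m : ℝ) + 2) = 2 * α + m + 1 + 1 by ring,
      show 2 * α + ((m : ℝ) + 1) = 2 * α + m + 1 by ring, e2, e1]
    have := Nat.factorial_ne_zero m
    field_simp
    ring

/-- `(α)_j / j!` -/
def pc (α : ℝ) (j : ℕ) : ℝ := Real.Gamma (α + j) / (Real.Gamma α * j.factorial)

lemma pc_nonneg (α : ℝ) (hα : 0 < α) (j : ℕ) : 0 ≤ pc α j := by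
  have := Real.Gamma_pos_of_pos hα
  have : 0 < Real.Gamma (α + j) := Real.Gamma_pos_of_pos (by positivity)
  unfold pc
  positivity

lemma pc_succ (α : ℝ) (hα : 0 < α) (j : ℕ) : ((j : ℝ) + 1) * pc α (j + 1) = (α + j) * pc α j := by
  have hΓ := (Real.Gamma_pos_of_pos hα).ne'
  unfold pc
  push_cast [Nat.factorial_succ]
  rw [← add_assoc, Real.Gamma_add_one (by positivity)]
  have := Nat.factorial_ne_zero j
  field_simp

def pser (α : ℝ) (z : ℂ) : PowerSeries ℂ := PowerSeries.mk fun j => (pc α j : ℂ) * z ^ j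

open PowerSeries in
lemma pser_deriv (α : ℝ) (hα : 0 < α) (z : ℂ) :
    (1 - C z * X) * derivative ℂ (pser α z) = C (α * z) * pser α z := by
  ext n
  have h : ((n : ℂ) + 1) * (pc α (n + 1) : ℂ) = (α + n) * pc α n := by
    exact_mod_cast congrArg (fun x : ℝ => (x : ℂ)) (pc_succ α hα n)
  rw [sub_mul, one_mul, mul_assoc, map_sub, coeff_C_mul, coeff_C_mul]
  rcases n with _ | n
  · simp [pser, coeff_derivative] at h ⊢
    linear_combination z * h
  · rw [coeff_succ_X_mul, coeff_derivative, coeff_derivative]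
    simp only [pser, coeff_mk]
    push_cast at h ⊢
    linear_combination z ^ (n + 2) * h

open PowerSeries in
lemma pser_mul_deriv (α : ℝ) (hα : 0 < α) (z w s : ℂ) (hzw : z * w = 1) (hs : z + w = s) :
    (1 - C s * X + X ^ 2) * derivative ℂ (pser α z * pser α w) =
      (C (α * s) - C (2 * α : ℂ) * X) * (pser α z * pser α w) := by
  have h1 := pser_deriv α hα z
  have h2 := pser_deriv α hα w
  have h3 : (C z : PowerSeries ℂ) * C w = 1 := by rw [← map_mul, hzw, map_one]
  subst hs
  rw [Derivation.leibniz]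
  simp only [smul_eq_mul, map_mul, map_add] at *
  have h4 : (C (2 : ℂ) : PowerSeries ℂ) = 2 := map_ofNat C 2
  rw [h4]
  linear_combination (1 - C w * X) * pser α w * h1 + (1 - C z * X) * pser α z * h2 -
    (X ^ 2 * derivative ℂ (pser α z) * pser α w + X ^ 2 * derivative ℂ (pser α w) * pser α z + 2 * C (α : ℂ) * X * pser α z * pser α w) * h3

open PowerSeries in
lemma geg_eq_coeff (α t : ℝ) (hα : 0 < α) (z w : ℂ) (hzw : z * w = 1) (hs : z + w = 2 * t)
    (m : ℕ) : (gegenbauer α m t : ℂ) = coeff m (pser α z * pser α w) := by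
  have hΓ := (Real.Gamma_pos_of_pos hα).ne'
  have key := pser_mul_deriv α hα z w _ hzw hs
  set G := pser α z * pser α w with hG
  have g0 : coeff 0 G = 1 := by
    simp [hG, pser, pc, hΓ]
  have hexp : ∀ D : PowerSeries ℂ, (1 - C (2 * t : ℂ) * X + X ^ 2) * D =
      D - C (2 * t : ℂ) * (X * D) + X * (X * D) := fun D => by ring
  have hexp2 : (C (α * (2 * t) : ℂ) - C (2 * α : ℂ) * X) * G =
      C (α * (2 * t) : ℂ) * G - C (2 * α : ℂ) * (X * G) := by ring
  rw [hexp, hexp2] at key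
  induction m using Nat.twoStepInduction with
  | zero => rw [geg_zero α t hα, g0]; simp
  | one =>
    have := congrArg (coeff 0) key
    simp only [map_add, map_sub, coeff_C_mul, coeff_derivative, coeff_zero_X_mul, g0] at this
    rw [geg_one α t hα]
    push_cast at this ⊢
    simp at this
    rw [this]; ring
  | more m ih1 ih2 =>
    have h := congrArg (fun x : ℝ => (x : ℂ)) (geg_rec α t hα m)
    push_cast at h
    rw [ih1, ih2] at h
    have hk := congrArg (coeff (m + 1)) key
    simp only [map_add, map_sub, coeff_C_mul, coeff_derivative, coeff_succ_X_mul] at hk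
    have hm : ((m : ℂ) + 2) ≠ 0 := by exact_mod_cast (by positivity : ((m : ℝ) + 2) ≠ 0)
    apply mul_left_cancel₀ hm
    rcases m with _ | m
    · simp at hk h ⊢
      linear_combination (h - hk) / 2
    · rw [coeff_succ_X_mul, coeff_derivative] at hk
      push_cast at hk h ⊢
      linear_combination h - hk

lemma geg_bound (α t : ℝ) (hα : 0 < α) (ht : t ∈ Set.Icc (-1 : ℝ) 1) (m : ℕ) :
    |gegenbauer α m t| ≤ gegenbauer α m 1 := by
  have h1 := geg_eq_coeff α 1 hα 1 1 (by norm_num) (by norm_num) m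
  have hθ : Real.cos (Real.arccos t) = t := Real.cos_arccos ht.1 ht.2
  set θ := Real.arccos t
  have ht' := geg_eq_coeff α t hα (Complex.exp (θ * Complex.I)) (Complex.exp (-θ * Complex.I))
    (by rw [← Complex.exp_add]; simp) (by
      rw [← hθ, Complex.ofReal_cos, Complex.two_cos]) m
  have hn1 : ‖Complex.exp (θ * Complex.I)‖ = 1 := Complex.norm_exp_ofReal_mul_I θ
  have hn2 : ‖Complex.exp (-θ * Complex.I)‖ = 1 := by
    exact_mod_cast Complex.norm_exp_ofReal_mul_I (-θ)
  rw [PowerSeries.coeff_mul] at h1 ht'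
  simp only [pser, PowerSeries.coeff_mk, one_pow, mul_one] at h1 ht'
  have h1' : gegenbauer α m 1 = ∑ p ∈ antidiagonal m, pc α p.1 * pc α p.2 := by
    exact_mod_cast h1
  rw [h1', ← Real.norm_eq_abs, ← Complex.norm_real, ht']
  refine (norm_sum_le _ _).trans (Finset.sum_le_sum fun p _ => ?_)
  rw [norm_mul, norm_mul, norm_mul, norm_pow, norm_pow, hn1, hn2, Complex.norm_real,
    Complex.norm_real, Real.norm_of_nonneg (pc_nonneg α hα _),
    Real.norm_of_nonneg (pc_nonneg α hα _)]
  simp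

/-- coefficients in the expansion of `t^n`. -/
def ec (α : ℝ) (n k : ℕ) : ℝ :=
  n.factorial * Real.Gamma α / (2 ^ n * k.factorial * Real.Gamma (α + n - k + 1))

def eE (α t : ℝ) (n k : ℕ) : ℝ :=
  if 2 * k ≤ n then ec α n k * (n - 2 * k + α) * gegenbauer α (n - 2 * k) t else 0

def eA (α t : ℝ) (n k : ℕ) : ℝ :=
  if 2 * k ≤ n then ec α n k / 2 * (n - 2 * k + 1) * gegenbauer α (n - 2 * k + 1) t else 0

def eB (α t : ℝ) (n k : ℕ) : ℝ :=
  if 2 * k + 1 ≤ n then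
    ec α n k / 2 * (n - 2 * k - 1 + 2 * α) * gegenbauer α (n - 2 * k - 1) t else 0

lemma eE_mul (α t : ℝ) (hα : 0 < α) (n k : ℕ) : t * eE α t n k = eA α t n k + eB α t n k := by
  rcases lt_or_ge n (2 * k) with h | h
  · simp only [eE, eA, eB]
    rw [if_neg (by omega), if_neg (by omega), if_neg (by omega)]
    ring
  obtain ⟨r, rfl⟩ := Nat.exists_eq_add_of_le h
  rcases r with _ | r
  · simp only [eE, eA, eB]
    rw [if_pos (by omega), if_pos (by omega), if_neg (by omega),
      show 2 * k + 0 - 2 * k = 0 by omega, geg_zero α t hα, zero_add, geg_one α t hα]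
    push_cast
    ring
  · simp only [eE, eA, eB]
    rw [if_pos (by omega), if_pos (by omega), if_pos (by omega),
      show 2 * k + (r + 1) - 2 * k = r + 1 by omega]
    have := geg_rec α t hα r
    simp only [Nat.add_sub_cancel]
    rw [show r + 1 + 1 = r + 2 by ring]
    push_cast
    linear_combination -ec α (2 * k + (r + 1)) k / 2 * this

lemma ec_succ_left (α : ℝ) (hα : 0 < α) (n k : ℕ) (h : k ≤ n) :
    ec α (n + 1) k * (2 * (α + n - k + 1)) = ec α n k * (n + 1) := by
  have hh : (k : ℝ) ≤ n := by exact_mod_cast h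
  have hp : 0 < α + n - k + 1 := by linarith
  have hG := (Real.Gamma_pos_of_pos hp).ne'
  unfold ec
  push_cast [Nat.factorial_succ]
  rw [show α + ((n : ℝ) + 1) - k + 1 = α + n - k + 1 + 1 by ring, Real.Gamma_add_one hp.ne']
  have := Nat.factorial_ne_zero k
  field_simp
  ring

lemma ec_succ_right (α : ℝ) (hα : 0 < α) (n k : ℕ) (h : k ≤ n) :
    ec α n (k + 1) * (k + 1) = ec α n k * (α + n - k) := by
  have hh : (k : ℝ) ≤ n := by exact_mod_cast h
  have hp : 0 < α + n - k := by linarith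
  have hG := (Real.Gamma_pos_of_pos hp).ne'
  unfold ec
  push_cast [Nat.factorial_succ]
  rw [Real.Gamma_add_one hp.ne', show α + (n : ℝ) - (k + 1) + 1 = α + n - k by ring]
  have := Nat.factorial_ne_zero k
  field_simp

lemma eE_zero (α t : ℝ) (hα : 0 < α) (n : ℕ) : eE α t (n + 1) 0 = eA α t n 0 := by
  have h := ec_succ_left α hα n 0 (Nat.zero_le _)
  simp only [eE, eA]
  rw [if_pos (by omega), if_pos (by omega)]
  simp only [mul_zero, Nat.sub_zero]
  push_cast at h ⊢
  linear_combination gegenbauer α (n + 1) t / 2 * h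

lemma eE_succ (α t : ℝ) (hα : 0 < α) (n k : ℕ) :
    eE α t (n + 1) (k + 1) = eA α t n (k + 1) + eB α t n k := by
  rcases lt_or_ge n (2 * k + 1) with h | h
  · simp only [eE, eA, eB]
    rw [if_neg (by omega), if_neg (by omega), if_neg (by omega)]
    ring
  obtain ⟨r, rfl⟩ := Nat.exists_eq_add_of_le h
  have hA : eA α t (2 * k + 1 + r) (k + 1) =
      ec α (2 * k + 1 + r) (k + 1) / 2 * r * gegenbauer α r t := by
    rcases r with _ | r
    · rw [eA, if_neg (by omega)]
      simp
    · rw [eA, if_pos (by omega), show 2 * k + 1 + (r + 1) - 2 * (k + 1) + 1 = r + 1 by omega]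
      push_cast
      ring
  rw [hA, eE, eB, if_pos (by omega), if_pos (by omega),
    show 2 * k + 1 + r + 1 - 2 * (k + 1) = r by omega,
    show 2 * k + 1 + r - 2 * k - 1 = r by omega]
  have h1 := ec_succ_left α hα (2 * k + 1 + r) (k + 1) (by omega)
  have h2 := ec_succ_right α hα (2 * k + 1 + r) k (by omega)
  push_cast at h1 h2 ⊢
  have hp : α + (2 * k + 1 + r) - k ≠ 0 := by
    have : 0 < α + k + 1 + r := by positivity
    linarith
  have e1 : ec α (2 * k + 1 + r + 1) (k + 1) =
      ec α (2 * k + 1 + r) (k + 1) * (2 * k + 1 + r + 1) / (2 * (α + (2 * k + 1 + r) - k)) := by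
    rw [eq_div_iff (by simpa using hp)]
    linear_combination h1
  have e2 : ec α (2 * k + 1 + r) k =
      ec α (2 * k + 1 + r) (k + 1) * (k + 1) / (α + (2 * k + 1 + r) - k) := by
    rw [eq_div_iff hp]
    linear_combination -h2
  rw [e1, e2]
  field_simp
  ring

lemma eE_sum (α t : ℝ) (hα : 0 < α) (n : ℕ) : ∑ k ∈ Finset.range (n + 1), eE α t n k = t ^ n := by
  induction n with
  | zero =>
    have hΓ := (Real.Gamma_pos_of_pos hα).ne'
    simp [eE, ec, geg_zero α t hα, Real.Gamma_add_one hα.ne']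
    field_simp
  | succ n ih =>
    rw [Finset.sum_range_succ', eE_zero α t hα]
    simp only [eE_succ α t hα, Finset.sum_add_distrib]
    have hA : eA α t n (n + 1) = 0 := by rw [eA, if_neg (by omega)]
    have h1 := Finset.sum_range_succ (eA α t n) (n + 1)
    rw [hA, Finset.sum_range_succ', add_zero] at h1
    rw [add_right_comm, h1, ← Finset.sum_add_distrib, pow_succ', ← ih, Finset.mul_sum]
    simp only [eE_mul α t hα]

lemma ec_nonneg (α : ℝ) (hα : 0 < α) (n k : ℕ) (h : k ≤ n) : 0 ≤ ec α n k := by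
  have hh : (k : ℝ) ≤ n := by exact_mod_cast h
  have h1 := Real.Gamma_pos_of_pos (show 0 < α + n - k + 1 by linarith)
  have h2 := Real.Gamma_pos_of_pos hα
  unfold ec
  positivity

lemma eE_bound (α t : ℝ) (hα : 0 < α) (ht : t ∈ Set.Icc (-1 : ℝ) 1) (n k : ℕ) :
    |eE α t n k| ≤ eE α 1 n k := by
  simp only [eE]
  split_ifs with h
  · have hh : 2 * (k : ℝ) ≤ n := by exact_mod_cast h
    have h1 := ec_nonneg α hα n k (by omega)
    have h2 : 0 ≤ ec α n k * (n - 2 * k + α) := mul_nonneg h1 (by linarith)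
    rw [abs_mul, abs_of_nonneg h2]
    exact mul_le_mul_of_nonneg_left (geg_bound α t hα ht _) h2
  · simp

lemma eE_tsum_zero (α t : ℝ) (n k : ℕ) (h : k ∉ Finset.range (n + 1)) : eE α t n k = 0 := by
  rw [eE, if_neg]
  simp only [Finset.mem_range] at h
  omega

lemma eE_hasSum (α t : ℝ) (hα : 0 < α) (n : ℕ) : HasSum (fun k => eE α t n k) (t ^ n) := by
  rw [← eE_sum α t hα n]
  exact hasSum_sum_of_ne_finset_zero fun k hk => eE_tsum_zero α t n k hk

lemma summable_H (α t : ℝ) (hα : 0 < α) (ht : t ∈ Set.Icc (-1 : ℝ) 1) (a : ℕ → ℂ)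
    (habs : Summable fun m : ℕ => ‖a m‖ / (Nat.factorial m)) :
    Summable fun p : ℕ × ℕ => a p.1 / (Nat.factorial p.1 : ℂ) * (eE α t p.1 p.2 : ℂ) := by
  have hnn : ∀ n k, 0 ≤ eE α 1 n k := fun n k => (abs_nonneg _).trans (eE_bound α t hα ht n k)
  have hb : Summable fun p : ℕ × ℕ => ‖a p.1‖ / (Nat.factorial p.1) * eE α 1 p.1 p.2 := by
    have h0 : (0 : ℕ × ℕ → ℝ) ≤ fun p : ℕ × ℕ => ‖a p.1‖ / (Nat.factorial p.1) * eE α 1 p.1 p.2 :=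
      fun p => mul_nonneg (div_nonneg (norm_nonneg _) (Nat.cast_nonneg _)) (hnn _ _)
    have hrow : ∀ n : ℕ, HasSum (fun k => ‖a n‖ / (Nat.factorial n) * eE α 1 n k)
        (‖a n‖ / (Nat.factorial n)) := by
      intro n
      have := (eE_hasSum α 1 hα n).mul_left (‖a n‖ / (Nat.factorial n))
      rwa [one_pow, mul_one] at this
    refine (summable_prod_of_nonneg h0).2 ⟨fun n => (hrow n).summable, ?_⟩
    exact habs.congr fun n => (hrow n).tsum_eq.symm
  refine Summable.of_norm_bounded hb fun p => ?_
  rw [norm_mul, norm_div, Complex.norm_natCast, Complex.norm_real, Real.norm_eq_abs]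
  exact mul_le_mul_of_nonneg_left (eE_bound α t hα ht _ _) (by positivity)

lemma expand_aux (α t : ℝ) (hα : 0 < α) (ht : t ∈ Set.Icc (-1 : ℝ) 1) (a : ℕ → ℂ)
    (habs : Summable fun m : ℕ => ‖a m‖ / (Nat.factorial m)) :
    ∑' n : ℕ, a n / (Nat.factorial n : ℂ) * (t : ℂ) ^ n =
      ∑' m : ℕ, ∑' k : ℕ, a (m + 2 * k) / (Nat.factorial (m + 2 * k) : ℂ) *
        (eE α t (m + 2 * k) k : ℂ) := by
  have hS := summable_H α t hα ht a habs
  have hinj : Function.Injective fun p : ℕ × ℕ => (p.1 + 2 * p.2, p.2) := by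
    rintro ⟨x, y⟩ ⟨x₂, y₂⟩ h
    simp only [Prod.mk.injEq] at h ⊢
    omega
  have hsupp : Function.support
      (fun p : ℕ × ℕ => a p.1 / (Nat.factorial p.1 : ℂ) * (eE α t p.1 p.2 : ℂ)) ⊆
      Set.range fun p : ℕ × ℕ => (p.1 + 2 * p.2, p.2) := by
    rintro ⟨n, k⟩ h
    by_cases hk : 2 * k ≤ n
    · refine ⟨(n - 2 * k, k), ?_⟩
      simp only [Prod.mk.injEq, and_true]
      omega
    · exact absurd (by simp [eE, hk]) h
  have h1 := hinj.tsum_eq hsupp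
  have hS2 := hS.comp_injective hinj
  have h2 := hS2.tsum_prod
  have h3 := hS.tsum_prod
  simp only [Function.comp_def] at h2
  rw [← h2, h1, h3]
  refine tsum_congr fun n => ?_
  have h4 := eE_hasSum α t hα n
  dsimp only
  rw [tsum_mul_left, ← Complex.ofReal_tsum, h4.tsum_eq, Complex.ofReal_pow]

lemma coeff_match (α t : ℝ) (hα : 0 < α) (m k : ℕ) :
    eE α t (m + 2 * k) k / (Nat.factorial (m + 2 * k)) =
      Real.Gamma (α + 1) * (1 / (2 ^ (m + 2 * k) * (Nat.factorial k) *
        Real.Gamma (α + m + k + 1)) * dimHarmonic α m *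
          (gegenbauer α m t / gegenbauer α m 1)) := by
  have h2 : 0 < 2 * α := by positivity
  have hΓ := (Real.Gamma_pos_of_pos hα).ne'
  have hΓ2 := (Real.Gamma_pos_of_pos h2).ne'
  have hΓ3 := (Real.Gamma_pos_of_pos (show 0 < α + m + k + 1 by positivity)).ne'
  have hΓ4 := (Real.Gamma_pos_of_pos (show 0 < 2 * α + m by positivity)).ne'
  have f1 := Nat.factorial_ne_zero m
  have f2 := Nat.factorial_ne_zero k
  have f3 := Nat.factorial_ne_zero (m + 2 * k)
  rw [geg_at_one α hα, dimHarmonic, eE, if_pos (by omega), ec, Real.Gamma_nat_eq_factorial,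
    Real.Gamma_add_one hα.ne', Real.Gamma_add_one h2.ne', Nat.add_sub_cancel]
  push_cast
  rw [show α + ((m : ℝ) + 2 * k) - k + 1 = α + m + k + 1 by ring]
  field_simp
  ring

/-- **Spherical Fourier expansion of zonal functions (Theorem 2).** Let `d ≥ 3`,
`α = (d-2)/2`, `η ∈ S^{d-1}`, and let `φ : [-1,1] → ℂ` have a Taylor expansion at `0`
absolutely convergent on `[-1,1]`. Then the zonal function `f(ξ) = φ((ξ|η))` has the
expansion `f(ξ) = Γ(α+1) Σ_m f_m (dim ℋ^m) Z^m_η(ξ)` with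
`f_m = Σ_k φ^{(m+2k)}(0)/(2^{m+2k} k! Γ(α+m+k+1))`. -/
theorem zonal_function_expansion (d : ℕ) (hd : 3 ≤ d)
    (α : ℝ) (hα : α = ((d : ℝ) - 2) / 2)
    (η : EuclideanSpace ℝ (Fin d)) (hη : ‖η‖ = 1)
    (φ : ℝ → ℂ)
    (habs : Summable fun m : ℕ => ‖iteratedDeriv m φ 0‖ / (Nat.factorial m))
    (hTaylor : ∀ t ∈ Set.Icc (-1 : ℝ) 1,
      φ t = ∑' m : ℕ, (iteratedDeriv m φ 0 / (Nat.factorial m : ℂ)) * (t : ℂ) ^ m)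
    (ξ : EuclideanSpace ℝ (Fin d)) (hξ : ‖ξ‖ = 1) :
    φ ⟪ξ, η⟫ =
      (Real.Gamma (α + 1) : ℂ) *
        ∑' m : ℕ,
          (∑' k : ℕ, iteratedDeriv (m + 2 * k) φ 0 /
              ((2 : ℂ) ^ (m + 2 * k) * (Nat.factorial k : ℂ) *
                (Real.Gamma (α + m + k + 1) : ℂ))) *
            (dimHarmonic α m : ℂ) * (zonalKernel d α m η ξ : ℂ) := by
  have hd' : (3 : ℝ) ≤ d := by exact_mod_cast hd
  have hα0 : 0 < α := by rw [hα]; linarith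
  have ht : ⟪ξ, η⟫ ∈ Set.Icc (-1 : ℝ) 1 := by
    rw [Set.mem_Icc, ← abs_le]
    simpa [hξ, hη] using abs_real_inner_le_norm ξ η
  rw [hTaylor _ ht, expand_aux α _ hα0 ht _ habs, ← tsum_mul_left]
  refine tsum_congr fun m => ?_
  rw [← tsum_mul_right, ← tsum_mul_right, ← tsum_mul_left]
  refine tsum_congr fun k => ?_
  have h := congrArg (fun x : ℝ => (x : ℂ)) (coeff_match α ⟪ξ, η⟫ hα0 m k)
  simp only [zonalKernel]
  push_cast at h ⊢
  rw [div_mul_eq_mul_div, mul_div_assoc, h]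
  ring

end
end
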